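/- Let K be a field of characteristic zero, R = K[x,y,z], and let a, b, α, β, γ be integers with 1 ≤ α ≤ a−1, 1 ≤ β ≤ b−1, 1 ≤ γ ≤ 2 and α + γ = b. Let I_β = (x^a, y^b − x^α z^γ, z^3, x^{a−α} y^{b−β}, y^{b−β} z^{3−γ}) and set k = ⌊(a+b−β)/2⌋. If 1 ≤ β ≤ a−b−2, then h_{R/I_β}(k) = h_{R/I_β}(k−1). -/

import Mathlib

open MvPolynomial

/-- The degree-`i` graded component of `R/I`, i.e. the image in `R/I` of the
space of homogeneous polynomials of degree `i`. -/
noncomputable def grComponent (K : Type*) [Field K]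
    (I : Ideal (MvPolynomial (Fin 3) K)) (i : ℕ) :
    Submodule K (MvPolynomial (Fin 3) K ⧸ I) :=
  (MvPolynomial.homogeneousSubmodule (Fin 3) K i).map
    (Ideal.Quotient.mkₐ K I).toLinearMap

/-- The Hilbert function of `R/I`. -/
noncomputable def hilb (K : Type*) [Field K]
    (I : Ideal (MvPolynomial (Fin 3) K)) (i : ℕ) : ℕ :=
  Module.finrank K (grComponent K I i)

/-- `R/I` has the weak Lefschetz property: there is a linear form `L` such that
for every `i`, multiplication by `L` from `[R/I]_i` to `[R/I]_{i+1}` is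
injective or surjective. -/
def hasWLP (K : Type*) [Field K] (I : Ideal (MvPolynomial (Fin 3) K)) : Prop :=
  ∃ L : MvPolynomial (Fin 3) K, L.IsHomogeneous 1 ∧
    ∀ i : ℕ,
      (∀ u ∈ grComponent K I i, ∀ v ∈ grComponent K I i,
          Ideal.Quotient.mk I L * u = Ideal.Quotient.mk I L * v → u = v) ∨
      (∀ w ∈ grComponent K I (i + 1), ∃ u ∈ grComponent K I i,
          Ideal.Quotient.mk I L * u = w)

theorem monomial_eq_smul_one {σ R : Type*} [CommSemiring R] (m : σ →₀ ℕ) (c : R) :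
    monomial m c = c • monomial m 1 := by
  rw [smul_monomial, smul_eq_mul, mul_one]

theorem hilb_succ_eq_of_mul {K : Type*} [Field K] {I : Ideal (MvPolynomial (Fin 3) K)} {n : ℕ}
    {L : MvPolynomial (Fin 3) K} (hL : L.IsHomogeneous 1)
    (inj : ∀ f : MvPolynomial (Fin 3) K, f.IsHomogeneous n → L * f ∈ I → f ∈ I)
    (surj : ∀ m : Fin 3 →₀ ℕ, m.degree = n + 1 → ∃ g : MvPolynomial (Fin 3) K,
      g.IsHomogeneous n ∧ monomial m 1 - L * g ∈ I) :
    hilb K I (n + 1) = hilb K I n := by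
  let T : grComponent K I n →ₗ[K] MvPolynomial (Fin 3) K ⧸ I :=
    LinearMap.mulLeft K (Ideal.Quotient.mk I L) ∘ₗ (grComponent K I n).subtype
  have hinj : Function.Injective T := by
    rw [← LinearMap.ker_eq_bot, LinearMap.ker_eq_bot']
    rintro ⟨u, f, hf, rfl⟩ h
    have h' : Ideal.Quotient.mk I (L * f) = 0 := by rw [map_mul]; exact h
    exact Subtype.ext (Ideal.Quotient.eq_zero_iff_mem.2
      (inj f hf (Ideal.Quotient.eq_zero_iff_mem.1 h')))
  have hrange : T.range = grComponent K I (n + 1) := by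
    apply le_antisymm
    · rintro _ ⟨⟨u, f, hf, rfl⟩, rfl⟩
      refine ⟨L * f, ?_, map_mul (Ideal.Quotient.mk I) L f⟩
      rw [add_comm]
      exact hL.mul hf
    · rintro _ ⟨f, hf, rfl⟩
      rw [← Submodule.mem_comap, f.as_sum]
      refine Submodule.sum_mem _ fun m hm => ?_
      obtain ⟨g, hg, hmem⟩ := surj m (by
        rw [Finsupp.degree_eq_weight_one]; exact hf (mem_support_iff.1 hm))
      rw [monomial_eq_smul_one]
      refine Submodule.smul_mem _ _ ⟨⟨_, g, hg, rfl⟩, ?_⟩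
      exact ((Ideal.Quotient.eq.2 hmem).trans (map_mul _ _ _)).symm
  rw [hilb, hilb, ← hrange, LinearMap.finrank_range_of_inj hinj]

/-- The exponent of the monomial obtained from the one with exponent `m` by rewriting
`y ^ b` to `x ^ α * z ^ γ` as often as possible. -/
noncomputable def reduceExp (b α γ : ℕ) (m : Fin 3 →₀ ℕ) : Fin 3 →₀ ℕ :=
  Finsupp.equivFunOnFinite.symm ![m 0 + m 1 / b * α, m 1 % b, m 2 + m 1 / b * γ]

/-- The monomial with exponent `m` avoids `x ^ a`, `z ^ 3`, `x ^ (a - α) * y ^ p` and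
`y ^ p * z ^ (3 - γ)`. -/
def IsStandard (a p α γ : ℕ) (m : Fin 3 →₀ ℕ) : Prop :=
  m 0 < a ∧ m 2 < 3 ∧ (p ≤ m 1 → m 0 < a - α ∧ m 2 < 3 - γ)

theorem degree_fin_three (m : Fin 3 →₀ ℕ) : m.degree = m 0 + m 1 + m 2 := by
  rw [Finsupp.degree_eq_sum, Fin.sum_univ_three]

section reduceExp

variable (b α γ : ℕ) (m : Fin 3 →₀ ℕ)

@[simp]
theorem reduceExp_zero : reduceExp b α γ m 0 = m 0 + m 1 / b * α := rfl

@[simp]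
theorem reduceExp_one : reduceExp b α γ m 1 = m 1 % b := rfl

@[simp]
theorem reduceExp_two : reduceExp b α γ m 2 = m 2 + m 1 / b * γ := rfl

theorem degree_reduceExp {b α γ : ℕ} (h : α + γ = b) (m : Fin 3 →₀ ℕ) :
    (reduceExp b α γ m).degree = m.degree := by
  rw [degree_fin_three, degree_fin_three, reduceExp_zero, reduceExp_one, reduceExp_two]
  have h1 := Nat.div_add_mod (m 1) b
  have h2 : b * (m 1 / b) = m 1 / b * α + m 1 / b * γ := by rw [← h]; ring
  omega

theorem reduceExp_add_single_zero (i : ℕ) :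
    reduceExp b α γ (m + Finsupp.single 0 i) = reduceExp b α γ m + Finsupp.single 0 i := by
  ext t
  fin_cases t <;> simp [add_right_comm]

theorem reduceExp_add_single_one {b : ℕ} (hb : 0 < b) :
    reduceExp b α γ (m + Finsupp.single 1 b) =
      reduceExp b α γ (m + (Finsupp.single 0 α + Finsupp.single 2 γ)) := by
  ext t
  fin_cases t <;> simp [Nat.add_div_right _ hb] <;> ring

theorem not_isStandard_reduceExp {a b p α γ : ℕ} {m : Fin 3 →₀ ℕ}
    (h : ¬ IsStandard a p α γ m) : ¬ IsStandard a p α γ (reduceExp b α γ m) := by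
  intro hs
  apply h
  obtain ⟨h0, h2, h1⟩ := hs
  simp only [reduceExp_zero, reduceExp_one, reduceExp_two] at h0 h1 h2
  refine ⟨by omega, by omega, fun hp => ?_⟩
  rcases Nat.eq_zero_or_pos (m 1 / b) with hq | hq
  · have := Nat.div_add_mod (m 1) b
    rw [hq] at this h1
    have := h1 (by omega)
    omega
  · have hα := Nat.le_mul_of_pos_left α hq
    have hγ := Nat.le_mul_of_pos_left γ hq
    omega

end reduceExp

section monomial

variable {K : Type*} [Field K]

theorem monomial_fin_three (m : Fin 3 →₀ ℕ) :
    (monomial m 1 : MvPolynomial (Fin 3) K) = X 0 ^ m 0 * X 1 ^ m 1 * X 2 ^ m 2 := by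
  rw [monomial_eq, Finsupp.prod_fintype _ _ fun _ => pow_zero _, Fin.prod_univ_three, C_1, one_mul]

theorem monomial_sub_monomial_reduceExp_mem {I : Ideal (MvPolynomial (Fin 3) K)} {b α γ : ℕ}
    (h : X 1 ^ b - X 0 ^ α * X 2 ^ γ ∈ I) (m : Fin 3 →₀ ℕ) :
    monomial m 1 - monomial (reduceExp b α γ m) 1 ∈ I := by
  rw [← Ideal.Quotient.eq] at h ⊢
  rw [monomial_fin_three, monomial_fin_three]
  simp only [map_mul, map_pow, reduceExp_zero, reduceExp_one, reduceExp_two] at h ⊢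
  conv_lhs => rw [← Nat.div_add_mod (m 1) b, pow_add, pow_mul, h]
  ring

theorem monomial_mem_of_not_isStandard {I : Ideal (MvPolynomial (Fin 3) K)} {a p α γ : ℕ}
    (hx : X 0 ^ a ∈ I) (hz : X 2 ^ 3 ∈ I) (hxy : X 0 ^ (a - α) * X 1 ^ p ∈ I)
    (hyz : X 1 ^ p * X 2 ^ (3 - γ) ∈ I) {m : Fin 3 →₀ ℕ} (hm : ¬ IsStandard a p α γ m) :
    monomial m 1 ∈ I := by
  rw [monomial_fin_three]
  by_cases h0 : a ≤ m 0
  · exact I.mem_of_dvd (((pow_dvd_pow _ h0).mul_right _).mul_right _) hx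
  by_cases h2 : 3 ≤ m 2
  · exact I.mem_of_dvd ((pow_dvd_pow _ h2).mul_left _) hz
  have h1 : p ≤ m 1 ∧ (a - α ≤ m 0 ∨ 3 - γ ≤ m 2) := by
    unfold IsStandard at hm
    omega
  obtain ⟨hp, h | h⟩ := h1
  · exact I.mem_of_dvd ((mul_dvd_mul (pow_dvd_pow _ h) (pow_dvd_pow _ hp)).mul_right _) hxy
  · rw [mul_assoc]
    exact I.mem_of_dvd ((mul_dvd_mul (pow_dvd_pow _ hp) (pow_dvd_pow _ h)).mul_left _) hyz

end monomial

open Classical in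
/-- The `K`-linear map sending each monomial to its normal form. -/
noncomputable def normalForm (K : Type*) [Field K] (a b p α γ : ℕ) :
    MvPolynomial (Fin 3) K →ₗ[K] MvPolynomial (Fin 3) K :=
  (basisMonomials (Fin 3) K).constr K fun m =>
    if IsStandard a p α γ (reduceExp b α γ m) then monomial (reduceExp b α γ m) 1 else 0

section normalForm

variable {K : Type*} [Field K] {a b p α γ : ℕ}

open Classical in
theorem normalForm_monomial (m : Fin 3 →₀ ℕ) :
    normalForm K a b p α γ (monomial m 1) =
      if IsStandard a p α γ (reduceExp b α γ m) then monomial (reduceExp b α γ m) 1 else 0 := by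
  have h := (basisMonomials (Fin 3) K).constr_basis K (fun m =>
    if IsStandard a p α γ (reduceExp b α γ m) then
      (monomial (reduceExp b α γ m) 1 : MvPolynomial (Fin 3) K) else 0) m
  rwa [coe_basisMonomials] at h

theorem normalForm_monomial_of_not_isStandard {m : Fin 3 →₀ ℕ} (h : ¬ IsStandard a p α γ m) :
    normalForm K a b p α γ (monomial m 1) = 0 := by
  rw [normalForm_monomial, if_neg (not_isStandard_reduceExp h)]

theorem normalForm_mul_eq_zero_of_mem_span {s : Set (MvPolynomial (Fin 3) K)}
    (hs : ∀ g ∈ s, ∀ m, normalForm K a b p α γ (monomial m 1 * g) = 0)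
    {f : MvPolynomial (Fin 3) K} (hf : f ∈ Ideal.span s) (r : MvPolynomial (Fin 3) K) :
    normalForm K a b p α γ (r * f) = 0 := by
  induction hf using Submodule.span_induction generalizing r with
  | mem g hg =>
    induction r using MvPolynomial.induction_on' with
    | monomial m c =>
      rw [monomial_eq_smul_one, smul_mul_assoc, map_smul, hs g hg,
        smul_zero]
    | add f₁ f₂ h₁ h₂ => rw [add_mul, map_add, h₁, h₂, add_zero]
  | zero => rw [mul_zero, map_zero]
  | add f g _ _ hf hg => rw [mul_add, map_add, hf, hg, add_zero]
  | smul q f _ hf => rw [smul_eq_mul, ← mul_assoc, hf]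

theorem sub_normalForm_mem {I : Ideal (MvPolynomial (Fin 3) K)}
    (hI : ∀ m, monomial m 1 - normalForm K a b p α γ (monomial m 1) ∈ I)
    (f : MvPolynomial (Fin 3) K) : f - normalForm K a b p α γ f ∈ I := by
  induction f using MvPolynomial.induction_on' with
  | monomial m c =>
    rw [monomial_eq_smul_one, map_smul, ← smul_sub]
    exact Submodule.smul_of_tower_mem I c (hI m)
  | add f g hf hg =>
    rw [map_add, add_sub_add_comm]
    exact I.add_mem hf hg

end normalForm

theorem stmt_15 (K : Type*) [Field K] [CharZero K] (a b α β γ : ℕ)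
    (hα1 : 1 ≤ α) (hα2 : α ≤ a - 1)
    (hβ1 : 1 ≤ β) (hβ2 : β ≤ b - 1)
    (hγ1 : 1 ≤ γ) (hγ2 : γ ≤ 2)
    (hαγ : α + γ = b)
    (hβ : (β : ℤ) ≤ (a : ℤ) - b - 2) :
    let I : Ideal (MvPolynomial (Fin 3) K) := Ideal.span {(X 0 : MvPolynomial (Fin 3) K) ^ a,
      X 1 ^ b - X 0 ^ α * X 2 ^ γ, X 2 ^ 3,
      X 0 ^ (a - α) * X 1 ^ (b - β), X 1 ^ (b - β) * X 2 ^ (3 - γ)}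
    let k : ℕ := (a + b - β) / 2
    hilb K I k = hilb K I (k - 1) := by
  intro I k
  obtain ⟨p, hp⟩ : ∃ p, p = b - β := ⟨_, rfl⟩
  obtain ⟨n, hn⟩ : ∃ n, k = n + 1 := ⟨k - 1, by omega⟩
  have hx : X 0 ^ a ∈ I := Ideal.subset_span (by simp)
  have hy : X 1 ^ b - X 0 ^ α * X 2 ^ γ ∈ I := Ideal.subset_span (by simp)
  have hz : X 2 ^ 3 ∈ I := Ideal.subset_span (by simp)
  have hxy : X 0 ^ (a - α) * X 1 ^ p ∈ I := Ideal.subset_span (by simp [hp])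
  have hyz : X 1 ^ p * X 2 ^ (3 - γ) ∈ I := Ideal.subset_span (by simp [hp])
  have hsub : ∀ f, f - normalForm K a b p α γ f ∈ I := by
    refine sub_normalForm_mem fun m => ?_
    have h := monomial_sub_monomial_reduceExp_mem hy m
    rw [normalForm_monomial]
    split_ifs with hs
    · exact h
    · rw [sub_zero]
      exact (Submodule.sub_mem_iff_left _
        (monomial_mem_of_not_isStandard hx hz hxy hyz hs)).1 h
  have hzero : ∀ f ∈ I, normalForm K a b p α γ f = 0 := by
    intro f hf
    rw [← one_mul f]
    refine normalForm_mul_eq_zero_of_mem_span ?_ hf 1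
    rintro g (rfl | rfl | rfl | rfl | rfl) m
    · rw [X_pow_eq_monomial, monomial_mul, one_mul]
      refine normalForm_monomial_of_not_isStandard fun h => ?_
      simp [IsStandard] at h
    · rw [mul_sub, map_sub, X_pow_eq_monomial, X_pow_eq_monomial, X_pow_eq_monomial,
        monomial_mul, monomial_mul, monomial_mul, one_mul, one_mul, normalForm_monomial,
        normalForm_monomial, reduceExp_add_single_one _ _ _ (by omega), sub_self]
    · rw [X_pow_eq_monomial, monomial_mul, one_mul]
      refine normalForm_monomial_of_not_isStandard fun h => ?_
      simp [IsStandard] at h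
    · rw [X_pow_eq_monomial, X_pow_eq_monomial, monomial_mul, monomial_mul, one_mul, one_mul]
      refine normalForm_monomial_of_not_isStandard fun h => ?_
      simp [IsStandard, hp] at h
    · rw [X_pow_eq_monomial, X_pow_eq_monomial, monomial_mul, monomial_mul, one_mul, one_mul]
      refine normalForm_monomial_of_not_isStandard fun h => ?_
      simp [IsStandard, hp] at h
  rw [hn, Nat.add_sub_cancel]
  refine hilb_succ_eq_of_mul (isHomogeneous_X K 0) (fun f hf hmem => ?_) fun m hm => ?_
  · have hcomm : normalForm K a b p α γ (X 0 * f) = X 0 * normalForm K a b p α γ f := by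
      rw [f.as_sum, Finset.mul_sum, map_sum, map_sum, Finset.mul_sum]
      refine Finset.sum_congr rfl fun m hm => ?_
      have hdeg : (reduceExp b α γ m).degree = n := by
        rw [degree_reduceExp hαγ, Finsupp.degree_eq_weight_one]
        exact hf (mem_support_iff.1 hm)
      have hstd : IsStandard a p α γ (reduceExp b α γ m + Finsupp.single 0 1) ↔
          IsStandard a p α γ (reduceExp b α γ m) := by
        rw [degree_fin_three] at hdeg
        simp only [IsStandard, Finsupp.add_apply, Finsupp.single_eq_same,
          Finsupp.single_eq_of_ne (show (1 : Fin 3) ≠ 0 by decide),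
          Finsupp.single_eq_of_ne (show (2 : Fin 3) ≠ 0 by decide)]
        omega
      rw [monomial_eq_smul_one m, mul_smul_comm, map_smul,
        map_smul, mul_smul_comm, mul_comm, X, monomial_mul, one_mul, normalForm_monomial,
        normalForm_monomial, reduceExp_add_single_zero, hstd, mul_ite, mul_zero, monomial_mul,
        one_mul, add_comm (Finsupp.single _ _)]
    have h0 : normalForm K a b p α γ f = 0 :=
      (mul_eq_zero.1 (hcomm.symm.trans (hzero _ hmem))).resolve_left (X_ne_zero 0)
    simpa [h0] using hsub f
  · have h := hsub (monomial m 1)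
    rw [normalForm_monomial] at h
    split_ifs at h with hs
    · have hdeg : (reduceExp b α γ m).degree = n + 1 := (degree_reduceExp hαγ m).trans hm
      have hlt : reduceExp b α γ m 1 < b := Nat.mod_lt _ (by omega)
      have hpos : 1 ≤ reduceExp b α γ m 0 := by
        rw [degree_fin_three] at hdeg
        unfold IsStandard at hs
        omega
      obtain ⟨s, hs'⟩ : ∃ s, reduceExp b α γ m = Finsupp.single 0 1 + s :=
        le_iff_exists_add.1 (Finsupp.single_le_iff.2 hpos)
      rw [hs'] at h hdeg
      refine ⟨monomial s 1, isHomogeneous_monomial _ ?_, ?_⟩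
      · rw [map_add, Finsupp.degree_single] at hdeg
        omega
      · rwa [X, monomial_mul, one_mul]
    · exact ⟨0, isHomogeneous_zero _ _ _, by simpa using h⟩
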